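/- arXiv:2309.04712 — 4 statements merged into one kernel-verified Lean document; each statement's English description precedes it below -/
import Mathlib

section
/- Suppose F, ψ and φ are nonnegative functions on [0,∞) such that: (i) there is a constant C_1 with ∫_t^{t+1} ψ(s) ds + ∫_t^{t+1} φ(s) ds ≤ C_1 for every t ≥ 0; (ii) there is a constant C_2 with sup_{s∈[t,t+1]} φ(s) ≤ C_2 · inf_{s∈[t,t+1]} φ(s) for every t ≥ 0; (iii) F is absolutely continuous and satisfies F'(t) + φ(t)F(t) ≤ ψ(t)φ(t) for almost every t ≥ 0. Then there exists M > 0, depending only on F(0), C_1 and C_2, such that F(t) ≤ M for all t ∈ [0,∞). -/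
open Set MeasureTheory

/-- If `φ` satisfies a Harnack-type inequality on `[t, t + 1]`, then each of its values there is
controlled by its average. -/
lemma le_mul_integral_of_harnack {φ : ℝ → ℝ} {t D : ℝ}
    (hφi : IntervalIntegrable φ volume t (t + 1))
    (hH : ∀ s1 ∈ Icc t (t + 1), ∀ s2 ∈ Icc t (t + 1), φ s1 ≤ D * φ s2)
    {s : ℝ} (hs : s ∈ Icc t (t + 1)) : φ s ≤ D * ∫ r in t..(t + 1), φ r := by
  have h := intervalIntegral.integral_mono_on (by linarith : t ≤ t + 1)
    (intervalIntegrable_const (c := φ s)) (hφi.const_mul D) (fun r hr => hH s hs r hr)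
  rw [intervalIntegral.integral_const, intervalIntegral.integral_const_mul] at h
  simpa using h

/-- Monotonicity of the interval integral under an inequality which holds almost everywhere on
the interval. -/
lemma integral_le_integral_of_ae_imp {f g : ℝ → ℝ} {x y : ℝ} (hxy : x ≤ y)
    (hf : IntervalIntegrable f volume x y) (hg : IntervalIntegrable g volume x y)
    (h : ∀ᵐ s ∂volume, s ∈ Icc x y → f s ≤ g s) :
    ∫ s in x..y, f s ≤ ∫ s in x..y, g s :=
  intervalIntegral.integral_mono_ae_restrict hxy hf hg
    ((ae_restrict_iff' measurableSet_Icc).2 h)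

/-- On a unit interval, a nonnegative solution of `F' + φ F ≤ ψ φ` grows by at most `D * C ^ 2`
between any two points, and if it starts below a level `K ≥ D * C + D * C ^ 2` then it also
ends below this level. -/
lemma unit_interval_bounds {F ψ φ F' : ℝ → ℝ} {t C D K : ℝ} (hC : 0 ≤ C) (hD : 0 ≤ D)
    (hK : D * C + D * C ^ 2 ≤ K)
    (hF : ∀ s ∈ Icc t (t + 1), 0 ≤ F s) (hψ : ∀ s ∈ Icc t (t + 1), 0 ≤ ψ s)
    (hφ : ∀ s ∈ Icc t (t + 1), 0 ≤ φ s)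
    (hψi : IntervalIntegrable ψ volume t (t + 1)) (hφi : IntervalIntegrable φ volume t (t + 1))
    (hsum : (∫ s in t..(t + 1), ψ s) + (∫ s in t..(t + 1), φ s) ≤ C)
    (hH : ∀ s1 ∈ Icc t (t + 1), ∀ s2 ∈ Icc t (t + 1), φ s1 ≤ D * φ s2)
    (hF'i : IntervalIntegrable F' volume t (t + 1))
    (hFF' : ∀ x ∈ Icc t (t + 1), ∀ y ∈ Icc t (t + 1), F y - F x = ∫ s in x..y, F' s)
    (hineq : ∀ᵐ s ∂volume, s ∈ Icc t (t + 1) → F' s + φ s * F s ≤ ψ s * φ s)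
    (hFt : F t ≤ K) :
    (∀ y ∈ Icc t (t + 1), F y ≤ K + D * C ^ 2) ∧ F (t + 1) ≤ K := by
  have ht : t ≤ t + 1 := by linarith
  have htl : t ∈ Icc t (t + 1) := left_mem_Icc.2 ht
  have htr : t + 1 ∈ Icc t (t + 1) := right_mem_Icc.2 ht
  set a := ∫ s in t..(t + 1), φ s
  set b := ∫ s in t..(t + 1), ψ s
  have ha0 : 0 ≤ a := intervalIntegral.integral_nonneg ht hφ
  have hb0 : 0 ≤ b := intervalIntegral.integral_nonneg ht hψ
  have hφa : ∀ s ∈ Icc t (t + 1), φ s ≤ D * a := fun s hs =>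
    le_mul_integral_of_harnack hφi hH hs
  have hDa : 0 ≤ D * a := mul_nonneg hD ha0
  have hDab : D * a * b ≤ D * a * C := mul_le_mul_of_nonneg_left (by linarith) hDa
  have hDaC : D * a * C ≤ D * C ^ 2 := by
    have : D * C * a ≤ D * C * C := mul_le_mul_of_nonneg_left (by linarith) (mul_nonneg hD hC)
    linarith
  have hψφ : ∀ s ∈ Icc t (t + 1), ψ s * φ s ≤ D * a * ψ s := fun s hs => by
    rw [mul_comm]
    exact mul_le_mul_of_nonneg_right (hφa s hs) (hψ s hs)
  have growth : ∀ x ∈ Icc t (t + 1), ∀ y ∈ Icc t (t + 1), x ≤ y → F y ≤ F x + D * C ^ 2 := by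
    intro x hx y hy hxy
    have hsub : Icc x y ⊆ Icc t (t + 1) := Icc_subset_Icc hx.1 hy.2
    have husub : uIcc x y ⊆ uIcc t (t + 1) := by rwa [uIcc_of_le hxy, uIcc_of_le ht]
    have h1 : ∫ s in x..y, F' s ≤ ∫ s in x..y, D * a * ψ s := by
      refine integral_le_integral_of_ae_imp hxy (hF'i.mono_set husub)
        ((hψi.mono_set husub).const_mul _) ?_
      filter_upwards [hineq] with s hs hsxy
      have hst := hsub hsxy
      linarith [hs hst, hψφ s hst, mul_nonneg (hφ s hst) (hF s hst)]
    have h2 : ∫ s in x..y, ψ s ≤ b :=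
      intervalIntegral.integral_mono_interval hx.1 hxy hy.2
        ((ae_restrict_iff' measurableSet_Ioc).2
          (ae_of_all _ fun s hs => hψ s (Ioc_subset_Icc_self hs))) hψi
    rw [intervalIntegral.integral_const_mul] at h1
    have h3 := mul_le_mul_of_nonneg_left h2 hDa
    linarith [hFF' x hx y hy]
  refine ⟨fun y hy => by linarith [growth t htl y hy hy.1], ?_⟩
  by_cases hlow : ∃ s ∈ Icc t (t + 1), F s < D * C
  · obtain ⟨s, hs, hFs⟩ := hlow
    linarith [growth s hs (t + 1) htr hs.2]
  · push Not at hlow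
    have h1 : ∫ s in t..(t + 1), F' s ≤ ∫ s in t..(t + 1), (D * a * ψ s - D * C * φ s) := by
      refine integral_le_integral_of_ae_imp ht hF'i
        ((hψi.const_mul _).sub (hφi.const_mul _)) ?_
      filter_upwards [hineq] with s hs hst
      linarith [hs hst, hψφ s hst, mul_le_mul_of_nonneg_left (hlow s hst) (hφ s hst)]
    rw [intervalIntegral.integral_sub (hψi.const_mul _) (hφi.const_mul _),
      intervalIntegral.integral_const_mul, intervalIntegral.integral_const_mul] at h1
    linarith [hFF' t htl (t + 1) htr]



/-- Tang–Yan–Xu–Zhong, Lemma 3.1: a discrete-like Gronwall lemma.  If `F` is absolutely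
continuous (written via its a.e. derivative `F'`) with `F' + φ F ≤ ψ φ` a.e. on `[0,∞)`,
`ψ` and `φ` are nonnegative with `‖ψ‖_{L¹(t,t+1)} + ‖φ‖_{L¹(t,t+1)} ≤ C₁` and
`sup_{[t,t+1]} φ ≤ C₂ inf_{[t,t+1]} φ`, then `F` is bounded by a constant `M` depending
only on `F 0`, `C₁` and `C₂`. -/
theorem stmt_3 (F0 C1 C2 : ℝ) :
    ∃ M : ℝ, 0 < M ∧
      ∀ (F ψ φ F' : ℝ → ℝ),
        (∀ t, 0 ≤ t → 0 ≤ F t) →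
        (∀ t, 0 ≤ t → 0 ≤ ψ t) →
        (∀ t, 0 ≤ t → 0 ≤ φ t) →
        (∀ t, 0 ≤ t → IntervalIntegrable ψ volume t (t + 1)) →
        (∀ t, 0 ≤ t → IntervalIntegrable φ volume t (t + 1)) →
        (∀ t, 0 ≤ t → (∫ s in t..(t + 1), ψ s) + (∫ s in t..(t + 1), φ s) ≤ C1) →
        (∀ t, 0 ≤ t → ∀ s1 ∈ Icc t (t + 1), ∀ s2 ∈ Icc t (t + 1), φ s1 ≤ C2 * φ s2) →
        (∀ t, 0 ≤ t → IntervalIntegrable F' volume 0 t) →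
        (∀ t, 0 ≤ t → F t = F 0 + ∫ s in (0 : ℝ)..t, F' s) →
        (∀ᵐ t ∂volume, 0 ≤ t → F' t + φ t * F t ≤ ψ t * φ t) →
        F 0 = F0 →
        ∀ t, 0 ≤ t → F t ≤ M := by
  set C := max C1 0
  set D := max C2 0
  have hC : 0 ≤ C := le_max_right _ _
  have hD : 0 ≤ D := le_max_right _ _
  set K := max F0 (D * C + D * C ^ 2)
  have hK : D * C + D * C ^ 2 ≤ K := le_max_right _ _
  have hDC : 0 ≤ D * C := mul_nonneg hD hC
  have hDC2 : 0 ≤ D * C ^ 2 := mul_nonneg hD (sq_nonneg C)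
  refine ⟨K + D * C ^ 2 + 1, by linarith, ?_⟩
  intro F ψ φ F' hF hψ hφ hψi hφi hsum hH hF'i hFF' hineq hF0
  have step : ∀ t, 0 ≤ t → F t ≤ K →
      (∀ y ∈ Icc t (t + 1), F y ≤ K + D * C ^ 2) ∧ F (t + 1) ≤ K := by
    intro t ht hFt
    have hnn : ∀ s ∈ Icc t (t + 1), 0 ≤ s := fun s hs => ht.trans hs.1
    refine unit_interval_bounds (ψ := ψ) (φ := φ) (F' := F') hC hD hK
      (fun s hs => hF s (hnn s hs)) (fun s hs => hψ s (hnn s hs))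
      (fun s hs => hφ s (hnn s hs)) (hψi t ht) (hφi t ht)
      ((hsum t ht).trans (le_max_left _ _)) ?_ ?_ ?_ ?_ hFt
    · intro s1 hs1 s2 hs2
      exact (hH t ht s1 hs1 s2 hs2).trans
        (mul_le_mul_of_nonneg_right (le_max_left _ _) (hφ s2 (hnn s2 hs2)))
    · exact (hF'i t ht).symm.trans (hF'i (t + 1) (by linarith))
    · intro x hx y hy
      have hx0 := hnn x hx
      have hy0 := hnn y hy
      rw [hFF' x hx0, hFF' y hy0,
        ← intervalIntegral.integral_interval_sub_left (hF'i y hy0) (hF'i x hx0)]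
      ring
    · filter_upwards [hineq] with s hs hst using hs (hnn s hst)
  have hnat : ∀ n : ℕ, F n ≤ K := by
    intro n
    induction n with
    | zero => rw [Nat.cast_zero, hF0]; exact le_max_left _ _
    | succ n ih =>
      push_cast
      exact (step n n.cast_nonneg ih).2
  intro t ht
  have h := (step ⌊t⌋₊ (Nat.cast_nonneg _) (hnat _)).1 t
    ⟨Nat.floor_le ht, (Nat.lt_floor_add_one t).le⟩
  linarith
end

section
/- Let M be a compact subset of a Banach space X and let V : M → X be uniformly quasi-differentiable on M, i.e. for each u ∈ M there is a bounded linear operator L(u) : X → X such that ‖V(v) − V(u) − L(u)(v − u)‖ ≤ ‖v − u‖·h(‖v − u‖) for all u, v ∈ M, where h : [0,∞) → [0,∞) satisfies h(s) → 0 as s → 0. Assume each quasi-derivative splits as L(u) = L¹(u) + L²(u) with sup_{u∈M} ‖L¹(u)‖ = q < 1 in operator norm, with L²(u) a compact operator on X for each u ∈ M, and with u ↦ L²(u) continuous in operator norm on M. If M ⊆ V(M), then the fractal dimension of M is finite. -/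
open Filter Metric Set

/-- The minimal number of closed balls of radius `ε` with centres in `K` needed to cover `K`. -/
noncomputable def coverN {X : Type*} [MetricSpace X] (K : Set X) (ε : ℝ) : ℕ :=
  sInf {n : ℕ | ∃ s : Finset X, (↑s : Set X) ⊆ K ∧
    K ⊆ (⋃ x ∈ s, closedBall x ε) ∧ s.card = n}

/-- The fractal (upper box-counting) dimension of `K`. -/
noncomputable def fractalDim {X : Type*} [MetricSpace X] (K : Set X) : EReal :=
  limsup (fun ε : ℝ => ((Real.log (coverN K ε : ℝ) / (-Real.log ε) : ℝ) : EReal))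
    (nhdsWithin 0 (Ioi 0))

/-- `c` colours `M` with `n` colours so that each colour class has diameter at most `d`. -/
def DiamColorable {X : Type*} [MetricSpace X] (M : Set X) (n : ℕ) (d : ℝ) : Prop :=
  ∃ c : X → Fin n, ∀ x ∈ M, ∀ y ∈ M, c x = c y → dist x y ≤ d

theorem TotallyBounded.exists_diamColorable {X : Type*} [MetricSpace X] {M : Set X}
    (hM : TotallyBounded M) {d : ℝ} (hd : 0 < d) : ∃ n, 0 < n ∧ DiamColorable M n d := by
  classical
  obtain ⟨t, ht, hMt⟩ := Metric.totallyBounded_iff.1 hM (d / 2) (half_pos hd)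
  have key : ∀ x : X, ∃ z : Option ht.toFinset, x ∈ M → ∃ w, z = some w ∧ dist x w < d / 2 := by
    intro x
    by_cases hx : x ∈ M
    · obtain ⟨y, hy, hxy⟩ := mem_iUnion₂.1 (hMt hx)
      exact ⟨some ⟨y, by simpa using hy⟩, fun _ => ⟨_, rfl, hxy⟩⟩
    · exact ⟨none, fun h => absurd h hx⟩
  choose f hf using key
  refine ⟨Fintype.card (Option ht.toFinset), Fintype.card_pos,
    fun x => Fintype.equivFin _ (f x), fun x hx y hy hxy => ?_⟩
  obtain ⟨a, ha, hxa⟩ := hf x hx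
  obtain ⟨b, hb, hyb⟩ := hf y hy
  have hab : a = b := by
    have := (Fintype.equivFin _).injective hxy
    rw [ha, hb] at this
    exact Option.some.inj this
  subst hab
  linarith [dist_triangle_right x y a.1]

theorem DiamColorable.coverN_le {X : Type*} [MetricSpace X] {M : Set X} {n : ℕ} {d ε : ℝ}
    (h : DiamColorable M n d) (hd : d ≤ ε) : coverN M ε ≤ n := by
  classical
  obtain ⟨c, hc⟩ := h
  have key : ∀ i : (c '' M), ∃ x ∈ M, c x = i := fun i => i.2
  choose r hrM hr using key
  let s : Finset X := Finset.univ.image r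
  have hs : s.card ≤ n := by
    refine Finset.card_image_le.trans ?_
    rw [Finset.card_univ]
    exact (Fintype.card_le_of_injective (Subtype.val : (c '' M) → Fin n)
      Subtype.val_injective).trans_eq (Fintype.card_fin n)
  refine le_trans (b := s.card) (Nat.sInf_le ⟨s, ?_, ?_, rfl⟩) hs
  · intro x hx
    obtain ⟨i, -, rfl⟩ := Finset.mem_image.1 hx
    exact hrM i
  · intro x hx
    refine mem_iUnion₂.2 ⟨r ⟨c x, x, hx, rfl⟩, Finset.mem_image_of_mem _ (Finset.mem_univ _), ?_⟩
    exact (hc x hx _ (hrM _) (hr ⟨c x, x, hx, rfl⟩).symm).trans hd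

/-- `V` squeezes `M` below scale `δ`: every subset of `M` of diameter at most `d ≤ δ` splits into
`N` pieces whose images have diameter at most `θ * d`. -/
def SqueezesOn {X : Type*} [MetricSpace X] (V : X → X) (M : Set X) (N : ℕ) (δ θ : ℝ) : Prop :=
  ∀ d, 0 < d → d ≤ δ → ∀ A ⊆ M, (∀ x ∈ A, ∀ y ∈ A, dist x y ≤ d) →
    ∃ k : X → Fin N, ∀ x ∈ A, ∀ y ∈ A, k x = k y → dist (V x) (V y) ≤ θ * d

theorem SqueezesOn.diamColorable_mul {X : Type*} [MetricSpace X] {V : X → X} {M : Set X}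
    {N n : ℕ} {δ θ d : ℝ} (hV : SqueezesOn V M N δ θ) (hMV : M ⊆ V '' M)
    (hd : 0 < d) (hdδ : d ≤ δ) (h : DiamColorable M n d) :
    DiamColorable M (n * N) (θ * d) := by
  classical
  obtain ⟨c, hc⟩ := h
  have hk : ∀ i : Fin n, ∃ k : X → Fin N, ∀ x ∈ M, ∀ y ∈ M, c x = i → c y = i → k x = k y →
      dist (V x) (V y) ≤ θ * d := by
    intro i
    obtain ⟨k, hk⟩ := hV d hd hdδ {x ∈ M | c x = i} (sep_subset _ _)
      fun x hx y hy => hc x hx.1 y hy.1 (hx.2.trans hy.2.symm)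
    exact ⟨k, fun x hx y hy hxi hyi => hk x ⟨hx, hxi⟩ y ⟨hy, hyi⟩⟩
  choose k hk using hk
  have hg : ∀ y : X, ∃ x : X, y ∈ M → x ∈ M ∧ V x = y := by
    intro y
    by_cases hy : y ∈ M
    · obtain ⟨x, hx⟩ := hMV hy
      exact ⟨x, fun _ => hx⟩
    · exact ⟨y, fun h => absurd h hy⟩
  choose g hg using hg
  refine ⟨fun y => finProdFinEquiv (c (g y), k (c (g y)) (g y)), fun x hx y hy hxy => ?_⟩
  obtain ⟨h1, h2⟩ := Prod.mk.inj (finProdFinEquiv.injective hxy)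
  rw [h1] at h2
  have := hk _ _ (hg x hx).1 _ (hg y hy).1 h1 rfl h2
  rwa [(hg x hx).2, (hg y hy).2] at this

theorem SqueezesOn.diamColorable_pow {X : Type*} [MetricSpace X] {V : X → X} {M : Set X}
    {N n : ℕ} {δ θ : ℝ} (hV : SqueezesOn V M N δ θ) (hMV : M ⊆ V '' M) (hδ : 0 < δ)
    (hθ : 0 < θ) (hθ1 : θ < 1) (h : DiamColorable M n δ) (m : ℕ) :
    DiamColorable M (n * N ^ m) (θ ^ m * δ) := by
  induction m with
  | zero => simpa using h
  | succ m ih =>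
    have := hV.diamColorable_mul hMV (by positivity)
      (mul_le_of_le_one_left hδ.le (pow_le_one₀ hθ.le hθ1.le)) ih
    rwa [mul_assoc, ← pow_succ, ← mul_assoc, ← pow_succ'] at this

theorem SqueezesOn.fractalDim_lt_top {X : Type*} [MetricSpace X] {V : X → X} {M : Set X}
    {N : ℕ} {δ θ : ℝ} (hV : SqueezesOn V M N δ θ) (hM : TotallyBounded M) (hMV : M ⊆ V '' M)
    (hN : 0 < N) (hδ : 0 < δ) (hθ : 0 < θ) (hθ1 : θ < 1) : fractalDim M < ⊤ := by
  obtain ⟨n, hn, hcol⟩ := hM.exists_diamColorable hδ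
  set l := -Real.log θ with hl
  have hlpos : 0 < l := neg_pos.2 (Real.log_neg hθ hθ1)
  have hlogn : 0 ≤ Real.log n := Real.log_natCast_nonneg n
  have hlogN : 0 ≤ Real.log N := Real.log_natCast_nonneg N
  set a := Real.log n + (|Real.log δ| / l + 1) * Real.log N with ha
  have ha0 : 0 ≤ a := by positivity
  have key : ∀ ε : ℝ, 0 < ε → ε < Real.exp (-1) →
      Real.log (coverN M ε) / (-Real.log ε) ≤ a + Real.log N / l := by
    intro ε hε hε1
    have hL : 1 < -Real.log ε := by
      have := Real.log_lt_log hε hε1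
      rw [Real.log_exp] at this
      linarith
    set m := ⌈(|Real.log δ| - Real.log ε) / l⌉₊ with hm
    have hx0 : 0 ≤ (|Real.log δ| - Real.log ε) / l :=
      div_nonneg (by linarith [abs_nonneg (Real.log δ)]) hlpos.le
    have hm1 : (|Real.log δ| - Real.log ε) ≤ m * l := (div_le_iff₀ hlpos).1 (Nat.le_ceil _)
    have hm2 : (m : ℝ) ≤ (|Real.log δ| - Real.log ε) / l + 1 := (Nat.ceil_lt_add_one hx0).le
    have hscale : θ ^ m * δ ≤ ε := by
      rw [← Real.log_le_log_iff (by positivity) hε, Real.log_mul (by positivity) hδ.ne',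
        Real.log_pow]
      have : (m : ℝ) * Real.log θ = -(m * l) := by rw [hl]; ring
      linarith [le_abs_self (Real.log δ)]
    have hcard : coverN M ε ≤ n * N ^ m :=
      (hV.diamColorable_pow hMV hδ hθ hθ1 hcol m).coverN_le hscale
    have hlog : Real.log (coverN M ε) ≤ Real.log n + m * Real.log N := by
      have hn' : (n : ℝ) ≠ 0 := by positivity
      have hN' : (N : ℝ) ^ m ≠ 0 := by positivity
      rw [← Real.log_pow, ← Real.log_mul hn' hN']
      rcases Nat.eq_zero_or_pos (coverN M ε) with h0 | h0
      · rw [h0]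
        simpa using Real.log_natCast_nonneg (n * N ^ m)
      · exact Real.log_le_log (by exact_mod_cast h0) (by exact_mod_cast hcard)
    rw [div_le_iff₀ (by linarith)]
    calc Real.log (coverN M ε) ≤ Real.log n + m * Real.log N := hlog
      _ ≤ Real.log n + ((|Real.log δ| - Real.log ε) / l + 1) * Real.log N := by gcongr
      _ = a + Real.log N / l * (-Real.log ε) := by rw [ha]; ring
      _ ≤ a * (-Real.log ε) + Real.log N / l * (-Real.log ε) := by nlinarith
      _ = _ := by ring
  refine lt_of_le_of_lt (limsup_le_of_le ?_ ?_) (EReal.coe_lt_top (a + Real.log N / l))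
  · isBoundedDefault
  · filter_upwards [Ioo_mem_nhdsGT (Real.exp_pos (-1))] with ε hε
    exact EReal.coe_le_coe_iff.2 (key ε hε.1 hε.2)

/-- The images of the unit ball under a compact continuous family of compact operators admit a
common finite net. -/
theorem exists_common_finite_net {X : Type*} [NormedAddCommGroup X] [NormedSpace ℝ X]
    {M : Set X} (hM : IsCompact M) {T : X → X →L[ℝ] X}
    (hT : ∀ u ∈ M, IsCompactOperator (⇑(T u))) (hTc : ContinuousOn T M) {η : ℝ} (hη : 0 < η) :
    ∃ Y : Finset X, ∀ u ∈ M, ∀ x, ‖x‖ ≤ 1 → ∃ y ∈ Y, ‖T u x - y‖ ≤ η := by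
  classical
  have hloc : ∀ u ∈ M, ∃ Y : Finset X, ∀ x, ‖x‖ ≤ 1 → ∃ y ∈ Y, ‖T u x - y‖ ≤ η / 2 := by
    intro u hu
    have htb : TotallyBounded (T u '' closedBall (0 : X) 1) :=
      ((hT u hu).isCompact_closure_image_closedBall (f := (T u : X →ₗ[ℝ] X)) 1).totallyBounded.subset
        subset_closure
    obtain ⟨Y, hY, hcov⟩ := Metric.totallyBounded_iff.1 htb (η / 2) (half_pos hη)
    refine ⟨hY.toFinset, fun x hx => ?_⟩
    obtain ⟨y, hy, hxy⟩ := mem_iUnion₂.1 (hcov (mem_image_of_mem _ (by simpa using hx)))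
    exact ⟨y, by simpa using hy, by rw [← dist_eq_norm]; exact (mem_ball.1 hxy).le⟩
  choose! Y hY using hloc
  obtain ⟨t, htM, ht⟩ := hM.elim_nhdsWithin_subcover (fun u => T ⁻¹' closedBall (T u) (η / 2))
    fun u hu => hTc u hu (closedBall_mem_nhds _ (half_pos hη))
  refine ⟨t.biUnion Y, fun u hu x hx => ?_⟩
  obtain ⟨v, hv, huv⟩ := mem_iUnion₂.1 (ht hu)
  obtain ⟨y, hy, hxy⟩ := hY v (htM v hv) x hx
  refine ⟨y, Finset.mem_biUnion.2 ⟨v, hv, hy⟩, ?_⟩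
  have h1 : ‖T u x - T v x‖ ≤ η / 2 := by
    have h2 : ‖T u - T v‖ ≤ η / 2 := by rw [← dist_eq_norm]; exact huv
    calc ‖T u x - T v x‖ = ‖(T u - T v) x‖ := by simp
      _ ≤ ‖T u - T v‖ * ‖x‖ := (T u - T v).le_opNorm x
      _ ≤ η / 2 * 1 := by gcongr
      _ = η / 2 := mul_one _
  linarith [norm_sub_le_norm_sub_add_norm_sub (T u x) (T v x) y]

/-- If the quasi-derivatives `L1 u + L2 u` of `V` are uniform contractions up to a continuous
family of compact operators, then
`V` squeezes `M` at small scales. -/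
theorem exists_squeezesOn {X : Type*} [NormedAddCommGroup X] [NormedSpace ℝ X]
    {M : Set X} (hM : IsCompact M) {V : X → X} {L1 L2 : X → X →L[ℝ] X} {h : ℝ → ℝ}
    (hhlim : Tendsto h (nhdsWithin 0 (Ici 0)) (nhds 0))
    (hquasi : ∀ u ∈ M, ∀ v ∈ M,
      ‖V v - V u - (L1 u + L2 u) (v - u)‖ ≤ ‖v - u‖ * h ‖v - u‖)
    {q : ℝ} (hq : q < 1) (hL1 : ∀ u ∈ M, ‖L1 u‖ ≤ q)
    (hL2cpt : ∀ u ∈ M, IsCompactOperator (⇑(L2 u))) (hL2cont : ContinuousOn L2 M) :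
    ∃ N δ θ, 0 < N ∧ 0 < δ ∧ 0 < θ ∧ θ < 1 ∧ SqueezesOn V M N δ θ := by
  classical
  set η := (1 - q) / 8 with hηdef
  have hη : 0 < η := by rw [hηdef]; linarith
  obtain ⟨Y, hY⟩ := exists_common_finite_net hM hL2cpt hL2cont hη
  obtain ⟨δ₁, hδ₁, hosc⟩ := Metric.uniformContinuousOn_iff.1
    (hM.uniformContinuousOn_of_continuous hL2cont) η hη
  obtain ⟨δ₂, hδ₂, hh⟩ := Metric.tendsto_nhdsWithin_nhds.1 hhlim η hη
  refine ⟨Fintype.card (Option Y), min δ₁ δ₂ / 2, max (q + 4 * η) (1 / 2), Fintype.card_pos,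
    by positivity, by positivity, max_lt (by rw [hηdef]; linarith) (by norm_num), ?_⟩
  intro d hd hdδ A hAM hA
  have hdδ₁ : d < δ₁ := by
    have := min_le_left δ₁ δ₂
    linarith
  have hdδ₂ : d < δ₂ := by
    have := min_le_right δ₁ δ₂
    linarith
  rcases A.eq_empty_or_nonempty with rfl | ⟨a, ha⟩
  · exact ⟨fun _ => Fintype.equivFin _ none, by simp⟩
  have key : ∀ x : X, ∃ z : Option Y, x ∈ A → ∃ y, z = some y ∧
      ‖L2 a (x - a) - d • (y : X)‖ ≤ d * η := by
    intro x
    by_cases hx : x ∈ A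
    · have hxa : ‖d⁻¹ • (x - a)‖ ≤ 1 := by
        rw [norm_smul, norm_inv, Real.norm_of_nonneg hd.le, ← dist_eq_norm]
        exact inv_mul_le_one_of_le₀ (hA x hx a ha) hd.le
      obtain ⟨y, hy, hxy⟩ := hY a (hAM ha) _ hxa
      refine ⟨some ⟨y, hy⟩, fun _ => ⟨_, rfl, ?_⟩⟩
      have : L2 a (x - a) - d • y = d • (L2 a (d⁻¹ • (x - a)) - y) := by
        rw [map_smul, smul_sub, smul_inv_smul₀ hd.ne']
      rw [this, norm_smul, Real.norm_of_nonneg hd.le]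
      gcongr
    · exact ⟨none, fun h => absurd h hx⟩
  choose f hf using key
  refine ⟨fun x => Fintype.equivFin _ (f x), fun x hx w hw hxw => ?_⟩
  obtain ⟨y, hy, hxy⟩ := hf x hx
  obtain ⟨z, hz, hwz⟩ := hf w hw
  have hyz : y = z := by
    have := (Fintype.equivFin _).injective hxw
    rw [hy, hz] at this
    exact Option.some.inj this
  subst hyz
  have hxwd : ‖x - w‖ ≤ d := by rw [← dist_eq_norm]; exact hA x hx w hw
  have hq0 : 0 ≤ q := (norm_nonneg _).trans (hL1 w (hAM hw))
  have e1 : ‖V x - V w - (L1 w + L2 w) (x - w)‖ ≤ d * η := by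
    refine (hquasi w (hAM hw) x (hAM hx)).trans ?_
    have hsmall : h ‖x - w‖ ≤ η := by
      have := hh (norm_nonneg (x - w)) (by simpa using hxwd.trans_lt hdδ₂)
      rw [dist_zero_right] at this
      exact (le_abs_self _).trans this.le
    exact (mul_le_mul_of_nonneg_left hsmall (norm_nonneg _)).trans (by gcongr)
  have e2 : ‖L1 w (x - w)‖ ≤ q * d := by
    refine ((L1 w).le_opNorm _).trans ?_
    have := hL1 w (hAM hw)
    gcongr
  have e3 : ‖(L2 w - L2 a) (x - w)‖ ≤ η * d := by
    refine ((L2 w - L2 a).le_opNorm _).trans ?_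
    have := hosc w (hAM hw) a (hAM ha) ((hA w hw a ha).trans_lt hdδ₁)
    rw [dist_eq_norm] at this
    gcongr
  have hdecomp : V x - V w = (V x - V w - (L1 w + L2 w) (x - w)) + L1 w (x - w)
      + (L2 w - L2 a) (x - w)
      + ((L2 a (x - a) - d • (y : X)) - (L2 a (w - a) - d • (y : X))) := by
    simp only [add_apply, sub_apply, map_sub]
    abel
  have hle : dist (V x) (V w) ≤ (q + 4 * η) * d := by
    rw [dist_eq_norm, hdecomp]
    refine (norm_add_le _ _).trans ?_
    have := norm_add₃_le (a := V x - V w - (L1 w + L2 w) (x - w)) (b := L1 w (x - w))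
      (c := (L2 w - L2 a) (x - w))
    have := norm_sub_le (L2 a (x - a) - d • (y : X)) (L2 a (w - a) - d • (y : X))
    linarith
  exact hle.trans (by gcongr; exact le_max_left _ _)

/-- Chueshov's criterion: a negatively invariant compact set on which the map is uniformly
quasi-differentiable, with quasi-derivatives splitting as a uniform contraction plus a
compact operator (continuous in the operator norm), has finite fractal dimension. -/
theorem stmt_5 {X : Type*} [NormedAddCommGroup X] [NormedSpace ℝ X] [CompleteSpace X]
    (M : Set X) (hM : IsCompact M) (V : X → X)
    (L L1 L2 : X → X →L[ℝ] X) (h : ℝ → ℝ)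
    (hhnn : ∀ s, 0 ≤ s → 0 ≤ h s)
    (hhlim : Tendsto h (nhdsWithin 0 (Ici 0)) (nhds 0))
    (hquasi : ∀ u ∈ M, ∀ v ∈ M, ‖V v - V u - L u (v - u)‖ ≤ ‖v - u‖ * h ‖v - u‖)
    (hsplit : ∀ u ∈ M, L u = L1 u + L2 u)
    (q : ℝ) (hq : q < 1) (hL1 : ∀ u ∈ M, ‖L1 u‖ ≤ q)
    (hL2cpt : ∀ u ∈ M, IsCompactOperator (⇑(L2 u)))
    (hL2cont : ContinuousOn L2 M)
    (hMV : M ⊆ V '' M) :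
    fractalDim M < ⊤ := by
  obtain ⟨N, δ, θ, hN, hδ, hθ, hθ1, hV⟩ := exists_squeezesOn hM hhlim
    (fun u hu v hv => hsplit u hu ▸ hquasi u hu v hv) hq hL1 hL2cpt hL2cont
  exact hV.fractalDim_lt_top hM.totallyBounded hMV hN hδ hθ hθ1
end

section
/- Let H be a real Hilbert space and p ∈ (1,2). There exists a constant C_p > 0, depending only on p, such that for all v_1, v_2 ∈ H: ‖ ‖v_1‖^p v_1 − ‖v_2‖^p v_2 ‖ ≤ ( C_p(‖v_1‖ + ‖v_2‖)^{p−1}‖v_1‖ + ‖v_2‖^p ) ‖v_1 − v_2‖. -/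
open Set

theorem rpow_sub_rpow_le_mul_sub {p x y : ℝ} (hp : 1 ≤ p) (hx : 0 ≤ x) (hxy : x ≤ y) :
    y ^ p - x ^ p ≤ p * y ^ (p - 1) * (y - x) := by
  rcases (hx.trans hxy).eq_or_lt with rfl | hy
  · obtain rfl : x = 0 := le_antisymm hxy hx
    simp
  · have h := one_add_mul_self_le_rpow_one_add (s := x / y - 1)
      (by linarith [div_nonneg hx hy.le]) hp
    rw [add_sub_cancel, Real.div_rpow hx hy.le, le_div_iff₀ (Real.rpow_pos_of_pos hy p)] at h
    have hpow : y ^ p = y ^ (p - 1) * y := by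
      rw [← Real.rpow_add_one hy.ne', sub_add_cancel]
    have hxy' : (1 + p * (x / y - 1)) * y ^ p = y ^ p - p * y ^ (p - 1) * (y - x) := by
      rw [hpow]
      field_simp
      ring
    linarith

theorem abs_rpow_sub_rpow_le {p a b : ℝ} (hp : 1 ≤ p) (ha : 0 ≤ a) (hb : 0 ≤ b) :
    |a ^ p - b ^ p| ≤ p * (a + b) ^ (p - 1) * |a - b| := by
  wlog hba : b ≤ a generalizing a b
  · rw [abs_sub_comm, abs_sub_comm a, add_comm]
    exact this hb ha (le_of_not_ge hba)
  · rw [abs_of_nonneg (sub_nonneg.2 (Real.rpow_le_rpow hb hba (by linarith))),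
      abs_of_nonneg (sub_nonneg.2 hba)]
    refine (rpow_sub_rpow_le_mul_sub hp hb hba).trans ?_
    have h : a ^ (p - 1) ≤ (a + b) ^ (p - 1) :=
      Real.rpow_le_rpow ha (by linarith) (by linarith)
    have := sub_nonneg.2 hba
    gcongr

/-- Local Lipschitz estimate for `v ↦ ‖v‖^p v` in a real Hilbert space, `p ∈ (1,2)`. -/
theorem stmt_6 {H : Type*} [NormedAddCommGroup H] [InnerProductSpace ℝ H]
    (p : ℝ) (hp : p ∈ Ioo (1 : ℝ) 2) :
    ∃ C : ℝ, 0 < C ∧ ∀ v1 v2 : H,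
      ‖(‖v1‖ ^ p) • v1 - (‖v2‖ ^ p) • v2‖ ≤
        (C * (‖v1‖ + ‖v2‖) ^ (p - 1) * ‖v1‖ + ‖v2‖ ^ p) * ‖v1 - v2‖ := by
  have hp0 : 0 < p := by linarith [hp.1]
  refine ⟨p, hp0, fun v1 v2 ↦ ?_⟩
  calc ‖(‖v1‖ ^ p) • v1 - (‖v2‖ ^ p) • v2‖
      = ‖(‖v1‖ ^ p - ‖v2‖ ^ p) • v1 + (‖v2‖ ^ p) • (v1 - v2)‖ := by
        congr 1
        module
    _ ≤ |‖v1‖ ^ p - ‖v2‖ ^ p| * ‖v1‖ + ‖v2‖ ^ p * ‖v1 - v2‖ := by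
        refine (norm_add_le _ _).trans_eq ?_
        rw [norm_smul, norm_smul, Real.norm_eq_abs, Real.norm_of_nonneg (by positivity)]
    _ ≤ p * (‖v1‖ + ‖v2‖) ^ (p - 1) * ‖v1 - v2‖ * ‖v1‖ + ‖v2‖ ^ p * ‖v1 - v2‖ := by
        gcongr
        refine (abs_rpow_sub_rpow_le hp.1.le (norm_nonneg v1) (norm_nonneg v2)).trans ?_
        gcongr
        exact abs_norm_sub_norm_le v1 v2
    _ = (p * (‖v1‖ + ‖v2‖) ^ (p - 1) * ‖v1‖ + ‖v2‖ ^ p) * ‖v1 - v2‖ := by ring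
end

section
/- Let f : ℝ → ℝ be differentiable, let μ_0 ∈ ℝ and M > 0 be such that f'(s) > −μ_0 for all |s| > M, and set F(s) = ∫_0^s f(τ) dτ. Then there exists a constant C ≥ 0 such that F(s) ≤ f(s)s + (μ_0/2)s² + C for all s with |s| > M. -/
theorem hasDerivAt_mul_id_add_sq_sub_integral {f : ℝ → ℝ} (hf : Differentiable ℝ f) (c s : ℝ) :
    HasDerivAt (fun s => f s * s + (c / 2) * s ^ 2 - ∫ τ in (0 : ℝ)..s, f τ)
      ((deriv f s + c) * s) s := by
  have hF : HasDerivAt (fun s => ∫ τ in (0 : ℝ)..s, f τ) (f s) s :=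
    hf.continuous.integral_hasStrictDerivAt 0 s |>.hasDerivAt
  refine ((((hf s).hasDerivAt.mul (hasDerivAt_id s)).add
    ((hasDerivAt_pow 2 s).const_mul (c / 2))).sub hF).congr_deriv ?_
  simp
  ring

/-- If `f' (s) > -μ₀` for `|s| > M`, then the primitive `F(s) = ∫_0^s f` satisfies
`F(s) ≤ f(s) s + (μ₀/2) s² + C` for `|s| > M`, for some constant `C ≥ 0`. -/
theorem stmt_9 (f : ℝ → ℝ) (hf : Differentiable ℝ f) (μ0 M : ℝ) (hM : 0 < M)
    (hderiv : ∀ s : ℝ, M < |s| → -μ0 < deriv f s) :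
    ∃ C : ℝ, 0 ≤ C ∧
      ∀ s : ℝ, M < |s| → (∫ τ in (0 : ℝ)..s, f τ) ≤ f s * s + (μ0 / 2) * s ^ 2 + C := by
  set G : ℝ → ℝ := fun s => f s * s + (μ0 / 2) * s ^ 2 - ∫ τ in (0 : ℝ)..s, f τ with hG
  have hG' : ∀ s, HasDerivAt G ((deriv f s + μ0) * s) s :=
    hasDerivAt_mul_id_add_sq_sub_integral hf μ0
  have hGd : Differentiable ℝ G := fun s => (hG' s).differentiableAt
  have hmono : MonotoneOn G (Set.Ici M) := by
    refine monotoneOn_of_deriv_nonneg (convex_Ici M) hGd.continuous.continuousOn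
      hGd.differentiableOn fun s hs => ?_
    rw [interior_Ici, Set.mem_Ioi] at hs
    rw [(hG' s).deriv]
    have := hderiv s (lt_abs.2 (Or.inl hs))
    exact mul_nonneg (by linarith) (by linarith)
  have hanti : AntitoneOn G (Set.Iic (-M)) := by
    refine antitoneOn_of_deriv_nonpos (convex_Iic (-M)) hGd.continuous.continuousOn
      hGd.differentiableOn fun s hs => ?_
    rw [interior_Iic, Set.mem_Iio] at hs
    rw [(hG' s).deriv]
    have := hderiv s (lt_abs.2 (Or.inr (by linarith)))
    exact mul_nonpos_of_nonneg_of_nonpos (by linarith) (by linarith)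
  refine ⟨|G M| + |G (-M)|, by positivity, fun s hs => ?_⟩
  suffices h : -(|G M| + |G (-M)|) ≤ G s by
    simp only [hG] at h ⊢
    linarith
  rcases lt_abs.1 hs with h | h
  · have := hmono Set.self_mem_Ici h.le h.le
    linarith [neg_abs_le (G M), abs_nonneg (G (-M))]
  · have hs' : s ≤ -M := by linarith
    have := hanti hs' Set.self_mem_Iic hs'
    linarith [neg_abs_le (G (-M)), abs_nonneg (G M)]
end
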